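/- arXiv:1005.1418 — 2 statements merged into one kernel-verified Lean document; each statement's English description precedes it below -/
import Mathlib

section
/- (Semi-discrete analogue of Darboux's theorem.) Let I ⊆ ℝ be an open interval, let f : ℝ → ℝ be continuous on I and tendable at every point of I, and let x₀ ∈ I be a strict local maximum or a strict local minimum of f. Then τ_f(x₀) = 0, and the sets {x ∈ I : τ_f(x) = 1} and {x ∈ I : τ_f(x) = −1} are both uncountable; in particular, the image of τ_f restricted to I is exactly {−1, 0, 1}. -/
/-- `HasRightDetachment f x d` means the right detachment `f₊^;(x)` exists and
equals `d`, i.e. `sgn (f (x + h) - f x) → d` as `h → 0⁺`. -/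
def HasRightDetachment (f : ℝ → ℝ) (x d : ℝ) : Prop :=
  Filter.Tendsto (fun h : ℝ => Real.sign (f (x + h) - f x))
    (nhdsWithin 0 (Set.Ioi 0)) (nhds d)

/-- `HasLeftDetachment f x d` means the left detachment `f₋^;(x)` exists and
equals `d`, i.e. `sgn (f (x + h) - f x) → d` as `h → 0⁻`. -/
def HasLeftDetachment (f : ℝ → ℝ) (x d : ℝ) : Prop :=
  Filter.Tendsto (fun h : ℝ => Real.sign (f (x + h) - f x))
    (nhdsWithin 0 (Set.Iio 0)) (nhds d)

/-- `f` is tendable at `x` if both one-sided detachments exist. -/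
def TendableAt (f : ℝ → ℝ) (x : ℝ) : Prop :=
  (∃ dp, HasRightDetachment f x dp) ∧ (∃ dm, HasLeftDetachment f x dm)

/-- `HasTendency f x t` means both one-sided detachments of `f` at `x` exist and
the tendency `τ_f(x) = sgn (f₊^;(x) - f₋^;(x))` equals `t`.  (Since limits in ℝ
are unique, this determines `t` uniquely whenever `f` is tendable at `x`.) -/
def HasTendency (f : ℝ → ℝ) (x t : ℝ) : Prop :=
  ∃ dp dm, HasRightDetachment f x dp ∧ HasLeftDetachment f x dm ∧
    Real.sign (dp - dm) = t

open Filter Set Topology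

theorem hasRightDetachment_iff {f : ℝ → ℝ} {x d : ℝ} :
    HasRightDetachment f x d ↔
      Tendsto (fun z => Real.sign (f z - f x)) (𝓝[>] x) (𝓝 d) := by
  have h := map_add_left_nhdsGT (c := x) (a := 0)
  rw [add_zero] at h
  rw [HasRightDetachment, ← h, tendsto_map'_iff]
  rfl

theorem hasLeftDetachment_iff {f : ℝ → ℝ} {x d : ℝ} :
    HasLeftDetachment f x d ↔
      Tendsto (fun z => Real.sign (f z - f x)) (𝓝[<] x) (𝓝 d) := by
  have h := map_add_left_nhdsLT (c := x) (a := 0)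
  rw [add_zero] at h
  rw [HasLeftDetachment, ← h, tendsto_map'_iff]
  rfl

theorem HasRightDetachment.neg {f : ℝ → ℝ} {x d : ℝ} (h : HasRightDetachment f x d) :
    HasRightDetachment (-f) x (-d) := by
  rw [hasRightDetachment_iff] at h ⊢
  refine h.neg.congr fun z => ?_
  rw [← Real.sign_neg]
  congr 1
  simp only [Pi.neg_apply]
  ring

theorem HasLeftDetachment.neg {f : ℝ → ℝ} {x d : ℝ} (h : HasLeftDetachment f x d) :
    HasLeftDetachment (-f) x (-d) := by
  rw [hasLeftDetachment_iff] at h ⊢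
  refine h.neg.congr fun z => ?_
  rw [← Real.sign_neg]
  congr 1
  simp only [Pi.neg_apply]
  ring

theorem TendableAt.neg {f : ℝ → ℝ} {x : ℝ} (h : TendableAt f x) : TendableAt (-f) x :=
  let ⟨⟨_, hp⟩, ⟨_, hm⟩⟩ := h
  ⟨⟨_, hp.neg⟩, ⟨_, hm.neg⟩⟩

theorem HasTendency.neg {f : ℝ → ℝ} {x t : ℝ} (h : HasTendency f x t) :
    HasTendency (-f) x (-t) := by
  obtain ⟨dp, dm, hp, hm, rfl⟩ := h
  refine ⟨_, _, hp.neg, hm.neg, ?_⟩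
  rw [← Real.sign_neg]
  congr 1
  ring

theorem hasTendency_neg_iff {f : ℝ → ℝ} {x t : ℝ} :
    HasTendency (-f) x t ↔ HasTendency f x (-t) :=
  ⟨fun h => by simpa using h.neg, fun h => by simpa using h.neg⟩

/-- The strict local minima of a real function form a countable set. -/
theorem countable_setOf_strict_local_min (f : ℝ → ℝ) :
    {x | ∀ᶠ z in 𝓝[≠] x, f x < f z}.Countable := by
  let B := TopologicalSpace.countableBasis ℝ
  have hB : TopologicalSpace.IsTopologicalBasis B :=
    TopologicalSpace.isBasis_countableBasis ℝ
  refine Countable.mono (s₂ := ⋃ U ∈ B, {x | x ∈ U ∧ ∀ z ∈ U, z ≠ x → f x < f z}) ?_ ?_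
  · intro x hx
    rw [mem_ofPred_eq, eventually_nhdsWithin_iff, hB.nhds_hasBasis.eventually_iff] at hx
    obtain ⟨U, ⟨hU, hxU⟩, h⟩ := hx
    exact mem_biUnion hU ⟨hxU, fun z hz hne => h hz hne⟩
  · refine (TopologicalSpace.countable_countableBasis ℝ).biUnion fun U _ => ?_
    refine Set.Subsingleton.countable fun x hx y hy => ?_
    by_contra hne
    exact lt_asymm (hx.2 y hy.1 (Ne.symm hne)) (hy.2 x hx.1 hne)

theorem hasTendency_one_or_strict_local_min {f : ℝ → ℝ} {x : ℝ} (hx : TendableAt f x)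
    (h : ∀ᶠ z in 𝓝[>] x, f x < f z) :
    HasTendency f x 1 ∨ ∀ᶠ z in 𝓝[≠] x, f x < f z := by
  obtain ⟨-, dm, hm⟩ := hx
  have hp : HasRightDetachment f x 1 := by
    rw [hasRightDetachment_iff]
    refine tendsto_const_nhds.congr' ?_
    filter_upwards [h] with z hz
    exact (Real.sign_of_pos (sub_pos.2 hz)).symm
  rcases lt_or_ge dm 1 with hlt | hge
  · exact .inl ⟨1, dm, hp, hm, Real.sign_of_pos (sub_pos.2 hlt)⟩
  · right
    rw [← Iio_union_Ioi, nhdsWithin_union, eventually_sup]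
    refine ⟨?_, h⟩
    rw [hasLeftDetachment_iff] at hm
    filter_upwards [hm.eventually_const_lt (zero_lt_one.trans_le hge)] with z hz
    by_contra hle
    rcases (not_lt.1 hle).lt_or_eq with hlt | heq
    · rw [Real.sign_of_neg (sub_neg.2 hlt)] at hz
      linarith
    · rw [heq, sub_self, Real.sign_zero] at hz
      exact lt_irrefl _ hz

/-- Every intermediate value of a continuous function that is smaller at the left endpoint
is attained at a last point, to the right of which the function is larger. -/
theorem exists_eq_and_forall_Ioc_lt {f : ℝ → ℝ} {c d y : ℝ} (hcd : c ≤ d)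
    (hf : ContinuousOn f (Icc c d)) (hy : y ∈ Ioo (f c) (f d)) :
    ∃ x ∈ Ico c d, f x = y ∧ ∀ z ∈ Ioc x d, y < f z := by
  have hcl : IsClosed (Icc c d ∩ f ⁻¹' Iic y) :=
    hf.preimage_isClosed_of_isClosed isClosed_Icc isClosed_Iic
  obtain ⟨x, ⟨hx, hxy⟩, hmax⟩ :=
    (isCompact_Icc.of_isClosed_subset hcl inter_subset_left).exists_isGreatest
      ⟨c, left_mem_Icc.2 hcd, hy.1.le⟩
  have hgt : ∀ z ∈ Ioc x d, y < f z := fun z hz => by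
    by_contra hle
    exact (hmax ⟨⟨hx.1.trans hz.1.le, hz.2⟩, not_lt.1 hle⟩).not_gt hz.1
  have hxd : x < d := hx.2.lt_of_ne fun h => (h ▸ hxy : f d ≤ y).not_gt hy.2
  refine ⟨x, ⟨hx.1, hxd⟩, ?_, hgt⟩
  obtain ⟨z, hz, hzy⟩ := intermediate_value_Icc hxd.le
    (hf.mono (Icc_subset_Icc_left hx.1)) ⟨hxy, hy.2.le⟩
  rcases hz.1.eq_or_lt with h | h
  · rw [h, hzy]
  · exact absurd hzy (hgt z ⟨h, hz.2⟩).ne'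

theorem not_countable_hasTendency_one {f : ℝ → ℝ} {c d : ℝ} (hcd : c ≤ d)
    (hf : ContinuousOn f (Icc c d)) (ht : ∀ x ∈ Icc c d, TendableAt f x) (hlt : f c < f d) :
    ¬ {x | x ∈ Icc c d ∧ HasTendency f x 1}.Countable := by
  intro hcount
  refine hlt.not_ge (Cardinal.Real.Ioo_countable_iff.1
    (((hcount.union (countable_setOf_strict_local_min f)).image f).mono fun y hy => ?_))
  obtain ⟨x, hx, rfl, hgt⟩ := exists_eq_and_forall_Ioc_lt hcd hf hy
  have hx' := Ico_subset_Icc_self hx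
  refine ⟨x, ?_, rfl⟩
  have hev : ∀ᶠ z in 𝓝[>] x, f x < f z := by
    filter_upwards [Ioc_mem_nhdsGT hx.2] with z hz using hgt z hz
  exact (hasTendency_one_or_strict_local_min (ht x hx') hev).imp (fun h => ⟨hx', h⟩) id

theorem not_countable_hasTendency_neg_one {f : ℝ → ℝ} {c d : ℝ} (hcd : c ≤ d)
    (hf : ContinuousOn f (Icc c d)) (ht : ∀ x ∈ Icc c d, TendableAt f x) (hlt : f d < f c) :
    ¬ {x | x ∈ Icc c d ∧ HasTendency f x (-1)}.Countable := by
  have h := not_countable_hasTendency_one hcd hf.neg (fun x hx => (ht x hx).neg)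
    (neg_lt_neg hlt)
  simpa only [hasTendency_neg_iff] using h

theorem tendency_of_strict_local_max {a b : ℝ} {f : ℝ → ℝ} (hcont : ContinuousOn f (Ioo a b))
    (htend : ∀ x ∈ Ioo a b, TendableAt f x) {x₀ : ℝ} (hx₀ : x₀ ∈ Ioo a b)
    (hmax : ∀ᶠ z in 𝓝[≠] x₀, f z < f x₀) :
    HasTendency f x₀ 0 ∧
    ¬ {x | x ∈ Ioo a b ∧ HasTendency f x 1}.Countable ∧
    ¬ {x | x ∈ Ioo a b ∧ HasTendency f x (-1)}.Countable := by
  rw [← Iio_union_Ioi, nhdsWithin_union, eventually_sup] at hmax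
  obtain ⟨hl, hr⟩ := hmax
  refine ⟨⟨-1, -1, ?_, ?_, by simp⟩, ?_, ?_⟩
  · rw [hasRightDetachment_iff]
    refine tendsto_const_nhds.congr' ?_
    filter_upwards [hr] with z hz
    exact (Real.sign_of_neg (sub_neg.2 hz)).symm
  · rw [hasLeftDetachment_iff]
    refine tendsto_const_nhds.congr' ?_
    filter_upwards [hl] with z hz
    exact (Real.sign_of_neg (sub_neg.2 hz)).symm
  · obtain ⟨c, hlt, hc⟩ := (hl.and (Ioo_mem_nhdsLT hx₀.1)).exists
    have hsub : Icc c x₀ ⊆ Ioo a b := Icc_subset_Ioo hc.1 hx₀.2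
    exact fun h => not_countable_hasTendency_one hc.2.le (hcont.mono hsub)
      (fun x hx => htend x (hsub hx)) hlt (h.mono (inter_subset_inter_left _ hsub))
  · obtain ⟨d, hlt, hd⟩ := (hr.and (Ioo_mem_nhdsGT hx₀.2)).exists
    have hsub : Icc x₀ d ⊆ Ioo a b := Icc_subset_Ioo hx₀.1 hd.2
    exact fun h => not_countable_hasTendency_neg_one hd.1.le (hcont.mono hsub)
      (fun x hx => htend x (hsub hx)) hlt (h.mono (inter_subset_inter_left _ hsub))

theorem tendency_of_strict_local_min {a b : ℝ} {f : ℝ → ℝ} (hcont : ContinuousOn f (Ioo a b))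
    (htend : ∀ x ∈ Ioo a b, TendableAt f x) {x₀ : ℝ} (hx₀ : x₀ ∈ Ioo a b)
    (hmin : ∀ᶠ z in 𝓝[≠] x₀, f x₀ < f z) :
    HasTendency f x₀ 0 ∧
    ¬ {x | x ∈ Ioo a b ∧ HasTendency f x 1}.Countable ∧
    ¬ {x | x ∈ Ioo a b ∧ HasTendency f x (-1)}.Countable := by
  have h := tendency_of_strict_local_max hcont.neg (fun x hx => (htend x hx).neg) hx₀
    (hmin.mono fun z hz => neg_lt_neg hz)
  simp only [hasTendency_neg_iff, neg_zero, neg_neg] at h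
  exact ⟨h.1, h.2.2, h.2.1⟩

theorem eventually_nhdsNE_of_abs_sub {p : ℝ → Prop} {x δ : ℝ} (hδ : 0 < δ)
    (h : ∀ z, 0 < |z - x| → |z - x| < δ → p z) : ∀ᶠ z in 𝓝[≠] x, p z := by
  rw [eventually_nhdsWithin_iff]
  filter_upwards [Metric.ball_mem_nhds x hδ] with z hz hne
  exact h z (abs_pos.2 (sub_ne_zero.2 hne)) hz

/-- Semi-discrete analogue of Darboux's theorem: if `f` is continuous and
tendable on an open interval `I` and `x₀ ∈ I` is a strict local maximum or a
strict local minimum of `f`, then `τ_f(x₀) = 0`, the tendency attains each of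
the values `1` and `-1` at uncountably many points of `I`, and the image of
`τ_f` on `I` is exactly `{-1, 0, 1}`. -/
theorem darboux_analogue_tendency (I : Set ℝ) (a b : ℝ) (hI : I = Set.Ioo a b)
    (f : ℝ → ℝ) (hcont : ContinuousOn f I)
    (htend : ∀ x ∈ I, TendableAt f x)
    (x₀ : ℝ) (hx₀ : x₀ ∈ I)
    (hext : ∃ δ > (0 : ℝ),
      (∀ x : ℝ, 0 < |x - x₀| → |x - x₀| < δ → f x < f x₀) ∨
      (∀ x : ℝ, 0 < |x - x₀| → |x - x₀| < δ → f x₀ < f x)) :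
    HasTendency f x₀ 0 ∧
    ¬ Set.Countable {x | x ∈ I ∧ HasTendency f x 1} ∧
    ¬ Set.Countable {x | x ∈ I ∧ HasTendency f x (-1)} ∧
    {t : ℝ | ∃ x ∈ I, HasTendency f x t} = {-1, 0, 1} := by
  subst hI
  obtain ⟨h0, h1, h2⟩ : HasTendency f x₀ 0 ∧
      ¬ {x | x ∈ Ioo a b ∧ HasTendency f x 1}.Countable ∧
      ¬ {x | x ∈ Ioo a b ∧ HasTendency f x (-1)}.Countable := by
    obtain ⟨δ, hδ, h | h⟩ := hext
    · exact tendency_of_strict_local_max hcont htend hx₀ (eventually_nhdsNE_of_abs_sub hδ h)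
    · exact tendency_of_strict_local_min hcont htend hx₀ (eventually_nhdsNE_of_abs_sub hδ h)
  refine ⟨h0, h1, h2, Subset.antisymm ?_ ?_⟩
  · rintro t ⟨x, -, dp, dm, -, -, rfl⟩
    exact Real.sign_apply_eq _
  · rintro t (rfl | rfl | rfl)
    · exact nonempty_iff_ne_empty.2 fun h => h2 (h ▸ countable_empty)
    · exact ⟨x₀, hx₀, h0⟩
    · exact nonempty_iff_ne_empty.2 fun h => h1 (h ▸ countable_empty)
end

section
/- Let α < β, let x, y : ℝ → ℝ, and suppose the curve γ : (α,β) → ℝ², γ(t) = (x(t), y(t)), is continuous and injective on (α,β). Let t₀ ∈ (α,β) and suppose all four one-sided detachments x₊^;(t₀), x₋^;(t₀), y₊^;(t₀), y₋^;(t₀) exist. Then none of the following four degenerate cases can occur: (1) x₊^;(t₀) = 0 and y₊^;(t₀) = 0; (2) x₋^;(t₀) = 0 and y₋^;(t₀) = 0; (3) x₊^;(t₀) = x₋^;(t₀) = 0 and y₊^;(t₀) = y₋^;(t₀); (4) y₊^;(t₀) = y₋^;(t₀) = 0 and x₊^;(t₀) = x₋^;(t₀). -/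
open Set Filter Topology

/-- A convergent family of signs is eventually equal to its limit. -/
lemma eventually_sign_eq_of_tendsto {ι : Type*} {l : Filter ι} [l.NeBot] {f : ι → ℝ} {d : ℝ}
    (h : Tendsto (fun i => Real.sign (f i)) l (𝓝 d)) : ∀ᶠ i in l, Real.sign (f i) = d := by
  have hmem (i : ι) : Real.sign (f i) ∈ ({-1, 0, 1} : Set ℝ) := by
    rcases Real.sign_apply_eq (f i) with h | h | h <;> simp [h]
  have hfin : ({-1, 0, 1} : Set ℝ).Finite := toFinite _
  have hd : d ∈ ({-1, 0, 1} : Set ℝ) := hfin.isClosed.mem_of_tendsto h (.of_forall hmem)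
  have hdist := Metric.tendsto_nhds.1 h 1 one_pos
  filter_upwards [hdist] with i hi
  rw [Real.dist_eq, abs_lt] at hi
  rcases hd with rfl | rfl | rfl <;> rcases hmem i with h | h | h <;>
    rw [h] at hi ⊢ <;> norm_num at hi

lemma HasRightDetachment.eventually {f : ℝ → ℝ} {t d : ℝ} (h : HasRightDetachment f t d) :
    ∀ᶠ s in 𝓝[>] t, Real.sign (f s - f t) = d := by
  have hsub : Tendsto (fun s => s - t) (𝓝[>] t) (𝓝[>] 0) := by
    refine tendsto_nhdsWithin_iff.2 ⟨?_, ?_⟩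
    · exact ((continuous_sub_right t).tendsto' t 0 (sub_self t)).mono_left nhdsWithin_le_nhds
    · filter_upwards [self_mem_nhdsWithin] with s hs using mem_Ioi.2 (sub_pos.2 (mem_Ioi.1 hs))
  simpa using hsub.eventually (eventually_sign_eq_of_tendsto h)

lemma HasLeftDetachment.eventually {f : ℝ → ℝ} {t d : ℝ} (h : HasLeftDetachment f t d) :
    ∀ᶠ s in 𝓝[<] t, Real.sign (f s - f t) = d := by
  have hsub : Tendsto (fun s => s - t) (𝓝[<] t) (𝓝[<] 0) := by
    refine tendsto_nhdsWithin_iff.2 ⟨?_, ?_⟩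
    · exact ((continuous_sub_right t).tendsto' t 0 (sub_self t)).mono_left nhdsWithin_le_nhds
    · filter_upwards [self_mem_nhdsWithin] with s hs using mem_Iio.2 (sub_neg.2 (mem_Iio.1 hs))
  simpa using hsub.eventually (eventually_sign_eq_of_tendsto h)

lemma eq_of_sign_sub_eq_zero {a b : ℝ} (h : Real.sign (a - b) = 0) : a = b :=
  sub_eq_zero.1 (Real.sign_eq_zero_iff.1 h)

/-- A continuous function lying strictly above its value at an interior point at both endpoints of
an interval takes a common value on the two sides of that point. -/
lemma exists_eq_of_lt_of_lt {f : ℝ → ℝ} {a b c : ℝ} (hac : a < c) (hcb : c < b)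
    (hf : ContinuousOn f (Icc a b)) (ha : f c < f a) (hb : f c < f b) :
    ∃ s ∈ Ico a c, ∃ t ∈ Ioc c b, f s = f t := by
  have hm : f c < min (f a) (f b) := lt_min ha hb
  obtain ⟨s, hs, hsm⟩ := intermediate_value_Icc' hac.le
    (hf.mono (Icc_subset_Icc_right hcb.le)) ⟨hm.le, min_le_left _ _⟩
  obtain ⟨t, ht, htm⟩ := intermediate_value_Icc hcb.le
    (hf.mono (Icc_subset_Icc_left hac.le)) ⟨hm.le, min_le_right _ _⟩
  refine ⟨s, ⟨hs.1, hs.2.lt_of_ne ?_⟩, t, ⟨ht.1.lt_of_ne ?_, ht.2⟩, hsm.trans htm.symm⟩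
  · rintro rfl
    exact hm.ne hsm
  · rintro rfl
    exact hm.ne htm

/-- If, along an injective curve `(u, v)` with `v` continuous, `u` has zero detachments at `t₀`,
then the detachments of `v` at `t₀` differ. -/
lemma detachment_ne_of_detachment_eq_zero {α β : ℝ} {u v : ℝ → ℝ}
    (hcont : ContinuousOn v (Ioo α β))
    (hinj : ∀ s ∈ Ioo α β, ∀ t ∈ Ioo α β, u s = u t → v s = v t → s = t)
    {t₀ : ℝ} (ht₀ : t₀ ∈ Ioo α β) {vp vm : ℝ}
    (hup : HasRightDetachment u t₀ 0) (hum : HasLeftDetachment u t₀ 0)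
    (hvp : HasRightDetachment v t₀ vp) (hvm : HasLeftDetachment v t₀ vm) : vp ≠ vm := by
  rintro rfl
  obtain ⟨b, hb, hright⟩ := mem_nhdsGT_iff_exists_Ioc_subset.1
    (hup.eventually.and (hvp.eventually.and (Ioo_mem_nhdsGT ht₀.2)))
  obtain ⟨a, ha, hleft⟩ := mem_nhdsLT_iff_exists_Ico_subset.1
    (hum.eventually.and (hvm.eventually.and (Ioo_mem_nhdsLT ht₀.1)))
  obtain ⟨-, hvb, hbI⟩ := hright ⟨hb, le_rfl⟩
  obtain ⟨-, hva, haI⟩ := hleft ⟨le_rfl, ha⟩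
  have hsub : Icc a b ⊆ Ioo α β := Icc_subset_Ioo haI.1 hbI.2
  have hne : ∀ s ∈ Ico a t₀, ∀ t ∈ Ioc t₀ b, v s ≠ v t := by
    intro s hs t ht hst
    refine (hs.2.trans ht.1).ne (hinj s (hsub ⟨hs.1, hs.2.le.trans (le_of_lt hb)⟩) t
      (hsub ⟨(le_of_lt ha).trans ht.1.le, ht.2⟩) ?_ hst)
    exact (eq_of_sign_sub_eq_zero (hleft hs).1).trans
      (eq_of_sign_sub_eq_zero (hright ht).1).symm
  have hsign : Real.sign (v a - v t₀) = Real.sign (v b - v t₀) := hva.trans hvb.symm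
  rcases lt_trichotomy (v b) (v t₀) with h | h | h
  · have h' : v a < v t₀ := by
      rw [Real.sign_of_neg (sub_neg.2 h)] at hsign
      by_contra! hle
      rcases hle.eq_or_lt with heq | hlt
      · rw [heq, sub_self, Real.sign_zero] at hsign
        norm_num at hsign
      · rw [Real.sign_of_pos (sub_pos.2 hlt)] at hsign
        norm_num at hsign
    obtain ⟨s, hs, t, ht, hst⟩ := exists_eq_of_lt_of_lt ha hb (hcont.mono hsub).neg
      (neg_lt_neg h') (neg_lt_neg h)
    exact hne s hs t ht (neg_injective hst)
  · rw [h, sub_self, Real.sign_zero] at hsign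
    exact hne a ⟨le_rfl, ha⟩ b ⟨hb, le_rfl⟩ ((eq_of_sign_sub_eq_zero hsign).trans h.symm)
  · have h' : v t₀ < v a := by
      rw [Real.sign_of_pos (sub_pos.2 h)] at hsign
      by_contra! hle
      rcases hle.eq_or_lt with heq | hlt
      · rw [heq, sub_self, Real.sign_zero] at hsign
        norm_num at hsign
      · rw [Real.sign_of_neg (sub_neg.2 hlt)] at hsign
        norm_num at hsign
    obtain ⟨s, hs, t, ht, hst⟩ := exists_eq_of_lt_of_lt ha hb (hcont.mono hsub) h' h
    exact hne s hs t ht hst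

/-- For a continuous, simple (injective) tendable curve `γ t = (x t, y t)` on
`(α, β)`, the tendency indicator vector `(x₊^;, x₋^;, y₊^;, y₋^;)` at an
interior point cannot take any of the four degenerate forms. -/
theorem tendency_indicator_vector_nondegenerate (α β : ℝ) (hαβ : α < β)
    (x y : ℝ → ℝ)
    (hcont : ContinuousOn (fun t => (x t, y t)) (Set.Ioo α β))
    (hinj : Set.InjOn (fun t => (x t, y t)) (Set.Ioo α β))
    (t₀ : ℝ) (ht₀ : t₀ ∈ Set.Ioo α β)
    (xp xm yp ym : ℝ)
    (hxp : HasRightDetachment x t₀ xp) (hxm : HasLeftDetachment x t₀ xm)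
    (hyp : HasRightDetachment y t₀ yp) (hym : HasLeftDetachment y t₀ ym) :
    ¬(xp = 0 ∧ yp = 0) ∧
    ¬(xm = 0 ∧ ym = 0) ∧
    ¬(xp = 0 ∧ xm = 0 ∧ yp = ym) ∧
    ¬(yp = 0 ∧ ym = 0 ∧ xp = xm) := by
  have hinj' : ∀ s ∈ Ioo α β, ∀ t ∈ Ioo α β, x s = x t → y s = y t → s = t :=
    fun s hs t ht hx hy => hinj hs ht (Prod.ext hx hy)
  refine ⟨?_, ?_, ?_, ?_⟩
  · rintro ⟨rfl, rfl⟩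
    obtain ⟨s, hx, hy, hs, hsβ⟩ :=
      (hxp.eventually.and (hyp.eventually.and (Ioo_mem_nhdsGT ht₀.2))).exists
    exact hs.ne' (hinj' s ⟨ht₀.1.trans hs, hsβ⟩ t₀ ht₀
      (eq_of_sign_sub_eq_zero hx) (eq_of_sign_sub_eq_zero hy))
  · rintro ⟨rfl, rfl⟩
    obtain ⟨s, hx, hy, hαs, hs⟩ :=
      (hxm.eventually.and (hym.eventually.and (Ioo_mem_nhdsLT ht₀.1))).exists
    exact hs.ne (hinj' s ⟨hαs, hs.trans ht₀.2⟩ t₀ ht₀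
      (eq_of_sign_sub_eq_zero hx) (eq_of_sign_sub_eq_zero hy))
  · rintro ⟨rfl, rfl, h⟩
    exact detachment_ne_of_detachment_eq_zero hcont.snd hinj' ht₀ hxp hxm hyp hym h
  · rintro ⟨rfl, rfl, h⟩
    exact detachment_ne_of_detachment_eq_zero hcont.fst
      (fun s hs t ht hy hx => hinj' s hs t ht hx hy) ht₀ hyp hym hxp hxm h
end
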